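/- Let i ∈ V and let K ⊆ V be an independent subset with {i} ⊊ K (so i ∈ K and K∖{i} is nonempty). Then Δ_K · M_i = Δ_{K∖{i}} as functions V → R (pointwise product). -/

import Mathlib

open MvPolynomial Finset

noncomputable section

abbrev Rr (n : ℕ) := MvPolynomial (Fin n) ℤ

/-- The "opposite" vertex: 0-indexed version of i ↦ 2n+1−i. -/
def bar {n : ℕ} (i : Fin (2*n)) : Fin (2*n) :=
  ⟨2*n - 1 - i.val, by have := i.isLt; omega⟩

/-- The weight α_i (0-indexed): α_i = X i for i < n, and α_i = −α_{bar i} otherwise. -/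
def av {n : ℕ} (i : Fin (2*n)) : Rr n :=
  if h : i.val < n then X ⟨i.val, h⟩
  else - X ⟨2*n - 1 - i.val, by have := i.isLt; omega⟩

/-- The axial function α(ij). -/
def ax {n : ℕ} (i j : Fin (2*n)) : Rr n :=
  if j = bar i then - av i else - av i + av j

/-- The class M_v. -/
def Mv {n : ℕ} (v : Fin (2*n)) : Fin (2*n) → Rr n := fun j =>
  if j = v then 0 else if j = bar v then 2 * av v else - av j + av v

/-- The class Q. -/
def Qf {n : ℕ} : Fin (2*n) → Rr n := fun j => - av j

/-- Independence: K contains no pair {i, bar i}. -/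
def indep {n : ℕ} (K : Finset (Fin (2*n))) : Prop :=
  ∀ i : Fin (2*n), ¬ ({i, bar i} : Finset (Fin (2*n))) ⊆ K

/-- The class Δ_K. -/
def Del {n : ℕ} (K : Finset (Fin (2*n))) : Fin (2*n) → Rr n := fun j =>
  if j ∈ K then ∏ k ∈ Kᶜ, ax j k else 0

/-- The class Δ'_K. -/
def Del' {n : ℕ} (K : Finset (Fin (2*n))) : Fin (2*n) → Rr n := fun j =>
  if j ∈ K then ∏ k ∈ (K ∪ {bar j})ᶜ, ax j k else 0

/-- The graph equivariant cohomology H*(GQ_{2n−1}) as a subring of the ring of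
functions V → R with pointwise operations. -/
def HGQ (n : ℕ) : Subring (Fin (2*n) → Rr n) where
  carrier := {f | ∀ i j : Fin (2*n), i ≠ j → ax i j ∣ f i - f j}
  zero_mem' := fun i j _ => by simp
  one_mem' := fun i j _ => by simp
  add_mem' := by
    intro a b ha hb i j h
    have e : (a + b) i - (a + b) j = (a i - a j) + (b i - b j) := by
      simp only [Pi.add_apply]; ring
    rw [e]; exact dvd_add (ha i j h) (hb i j h)
  neg_mem' := by
    intro a ha i j h
    have e : (-a) i - (-a) j = -(a i - a j) := by
      simp only [Pi.neg_apply]; ring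
    rw [e]; exact dvd_neg.mpr (ha i j h)
  mul_mem' := by
    intro a b ha hb i j h
    have e : (a * b) i - (a * b) j = a i * (b i - b j) + (a i - a j) * b j := by
      simp only [Pi.mul_apply]; ring
    rw [e]; exact dvd_add ((hb i j h).mul_left _) ((ha i j h).mul_right _)

/-- The graph equivariant cohomology H*(GQ_{2n−2}) (edges i j with j ≠ bar i only). -/
def HGQe (n : ℕ) : Subring (Fin (2*n) → Rr n) where
  carrier := {f | ∀ i j : Fin (2*n), i ≠ j → j ≠ bar i → ax i j ∣ f i - f j}
  zero_mem' := fun i j _ _ => by simp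
  one_mem' := fun i j _ _ => by simp
  add_mem' := by
    intro a b ha hb i j h h'
    have e : (a + b) i - (a + b) j = (a i - a j) + (b i - b j) := by
      simp only [Pi.add_apply]; ring
    rw [e]; exact dvd_add (ha i j h h') (hb i j h h')
  neg_mem' := by
    intro a ha i j h h'
    have e : (-a) i - (-a) j = -(a i - a j) := by
      simp only [Pi.neg_apply]; ring
    rw [e]; exact dvd_neg.mpr (ha i j h h')
  mul_mem' := by
    intro a b ha hb i j h h'
    have e : (a * b) i - (a * b) j = a i * (b i - b j) + (a i - a j) * b j := by
      simp only [Pi.mul_apply]; ring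
    rw [e]; exact dvd_add ((hb i j h h').mul_left _) ((ha i j h h').mul_right _)


theorem bar_bar {n : ℕ} (i : Fin (2*n)) : bar (bar i) = i := by
  ext
  simp only [bar]
  omega

theorem indep.bar_notMem {n : ℕ} {K : Finset (Fin (2*n))} (hK : indep K) {i : Fin (2*n)}
    (hi : i ∈ K) : bar i ∉ K := fun h =>
  hK i (by simp [Finset.insert_subset_iff, hi, h])

theorem Mv_eq_ax {n : ℕ} {i j : Fin (2*n)} (hji : j ≠ i) (hj : j ≠ bar i) :
    Mv i j = ax j i := by
  have hi : i ≠ bar j := fun h => hj (by rw [h, bar_bar])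
  simp only [Mv, ax, if_neg hji, if_neg hj, if_neg hi]

/-- Relation 4: if K is independent and {i} ⊊ K, then
Δ_K · M_i = Δ_{K∖{i}} pointwise. -/
theorem stmt8 (n : ℕ) (hn : 1 ≤ n) (i : Fin (2*n)) (K : Finset (Fin (2*n)))
    (hK : indep K) (hiK : ({i} : Finset (Fin (2*n))) ⊂ K) :
    Del K * Mv i = Del (K.erase i) := by
  have hi : i ∈ K := Finset.singleton_subset_iff.mp hiK.subset
  funext j
  rw [Pi.mul_apply]
  by_cases hj : j ∈ K
  · by_cases hji : j = i
    · simp [Del, Mv, hji]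
    · have hjb : j ≠ bar i := fun h => hK.bar_notMem hi (h ▸ hj)
      rw [Mv_eq_ax hji hjb, Del, Del, if_pos hj, if_pos (Finset.mem_erase.mpr ⟨hji, hj⟩),
        Finset.compl_erase, Finset.prod_insert (by simpa using hi), mul_comm]
  · simp [Del, hj]

end
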